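/- arXiv:1801.02777 — 3 statements merged into one kernel-verified Lean document; each statement's English description precedes it below -/
import Mathlib

section
/- Let N ≥ 1 be an integer, α > 0 and β ∈ ℝ. Then there exist constants C > 0 and t₀ > 0 such that for all t ≥ t₀: (1/C)·(αt)^β·e^{αt} ≤ Σ_{k=N}^∞ ((αt)^k / k!)·k^β ≤ C·(αt)^β·e^{αt}. -/
open Filter Topology

/-- A real power of `r > 0` with exponent of size at most `m` is bounded by `r ^ m + (r ^ m)⁻¹`. -/
theorem rpow_le_pow_add_inv_pow {r β : ℝ} (hr : 0 < r) {m : ℕ} (hm : |β| ≤ m) :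
    r ^ β ≤ r ^ m + (r ^ m)⁻¹ := by
  have hb := abs_le.1 hm
  have hpos : 0 < r ^ m := pow_pos hr m
  have hinv : 0 < (r ^ m)⁻¹ := inv_pos.2 hpos
  rcases le_total 1 r with h | h
  · have := Real.rpow_le_rpow_of_exponent_le h hb.2
    rw [Real.rpow_natCast] at this
    linarith
  · have := Real.rpow_le_rpow_of_exponent_ge hr h hb.1
    rw [Real.rpow_neg hr.le, Real.rpow_natCast] at this
    linarith

theorem pow_le_const_add_descFactorial (n m : ℕ) :
    n ^ m ≤ (2 * m) ^ m + 2 ^ m * n.descFactorial m := by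
  rcases lt_or_ge n (2 * m) with h | h
  · exact (Nat.pow_le_pow_left h.le m).trans (Nat.le_add_right _ _)
  · calc n ^ m ≤ (2 * (n + 1 - m)) ^ m := Nat.pow_le_pow_left (by omega) m
      _ = 2 ^ m * (n + 1 - m) ^ m := mul_pow _ _ _
      _ ≤ 2 ^ m * n.descFactorial m :=
        Nat.mul_le_mul_left _ (Nat.pow_sub_le_descFactorial n m)
      _ ≤ _ := Nat.le_add_left _ _

theorem factorial_add_le_mul_pow {n : ℕ} (hn : 1 ≤ n) (m : ℕ) :
    (n + m).factorial ≤ n.factorial * ((1 + m) ^ m * n ^ m) := by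
  rw [← Nat.factorial_mul_ascFactorial, ← mul_pow]
  refine Nat.mul_le_mul_left _ ((Nat.ascFactorial_le_pow_add n m).trans ?_)
  exact Nat.pow_le_pow_left (by nlinarith) m

theorem hasSum_pow_div_factorial (x : ℝ) :
    HasSum (fun n : ℕ => x ^ n / (n.factorial : ℝ)) (Real.exp x) := by
  rw [Real.exp_eq_exp_ℝ]
  exact NormedSpace.expSeries_div_hasSum_exp x

/-- The factorial moments of the Poisson weights. -/
theorem hasSum_pow_div_factorial_mul_descFactorial {x : ℝ} (hx : x ≠ 0) (m : ℕ) :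
    HasSum (fun n : ℕ => x ^ n / (n.factorial : ℝ) * (n.descFactorial m / x ^ m))
      (Real.exp x) := by
  refine ((add_left_injective m).hasSum_iff ?_).1 ?_
  · intro n hn
    have : n < m := by
      by_contra! h
      exact hn ⟨n - m, Nat.sub_add_cancel h⟩
    simp [Nat.descFactorial_of_lt this]
  · convert hasSum_pow_div_factorial x using 1
    funext n
    have h := Nat.factorial_mul_descFactorial (Nat.le_add_left m n)
    rw [Nat.add_sub_cancel] at h
    have h' : (n.factorial : ℝ) * ((n + m).descFactorial m : ℝ) = (n + m).factorial := by
      exact_mod_cast h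
    have hf : (n.factorial : ℝ) ≠ 0 := by positivity
    have hd : ((n + m).descFactorial m : ℝ) ≠ 0 := by
      intro h0
      rw [h0, mul_zero] at h'
      have : ((n + m).factorial : ℝ) ≠ 0 := by positivity
      exact this h'.symm
    simp only [Function.comp_apply]
    rw [← h', pow_add]
    field_simp

/-- A termwise bound of the weighted exponential series by three summable series. -/
theorem pow_div_factorial_mul_rpow_le {x β : ℝ} (hx : 1 ≤ x) {m : ℕ} (hm : |β| ≤ m)
    {n : ℕ} (hn : 1 ≤ n) :
    x ^ n / (n.factorial : ℝ) * (n : ℝ) ^ β ≤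
      x ^ β * ((2 * m : ℝ) ^ m * (x ^ n / (n.factorial : ℝ)) +
        2 ^ m * (x ^ n / (n.factorial : ℝ) * (n.descFactorial m / x ^ m)) +
        (1 + m : ℝ) ^ m * (x ^ (n + m) / ((n + m).factorial : ℝ))) := by
  have hx0 : 0 < x := by linarith
  have hn0 : (0 : ℝ) < n := by exact_mod_cast hn
  have hr : 0 < (n : ℝ) / x := by positivity
  have hsplit : (n : ℝ) ^ β = x ^ β * ((n : ℝ) / x) ^ β := by
    rw [← Real.mul_rpow hx0.le hr.le, mul_div_cancel₀ _ hx0.ne']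
  have hxm : 1 ≤ x ^ m := one_le_pow₀ hx
  have hP : 0 < x ^ n / (n.factorial : ℝ) := by positivity
  have h1 : x ^ n / (n.factorial : ℝ) * ((n : ℝ) / x) ^ m ≤
      (2 * m : ℝ) ^ m * (x ^ n / (n.factorial : ℝ)) +
        2 ^ m * (x ^ n / (n.factorial : ℝ) * (n.descFactorial m / x ^ m)) := by
    have h : (n : ℝ) ^ m ≤ (2 * m : ℝ) ^ m + 2 ^ m * n.descFactorial m := by
      exact_mod_cast pow_le_const_add_descFactorial n m
    have h' : ((n : ℝ) / x) ^ m ≤ (2 * m : ℝ) ^ m + 2 ^ m * (n.descFactorial m / x ^ m) := by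
      rw [div_pow]
      calc (n : ℝ) ^ m / x ^ m
          ≤ ((2 * m : ℝ) ^ m + 2 ^ m * n.descFactorial m) / x ^ m := by gcongr
        _ = (2 * m : ℝ) ^ m / x ^ m + 2 ^ m * (n.descFactorial m / x ^ m) := by ring
        _ ≤ _ := by
          gcongr
          exact div_le_self (by positivity) hxm
    calc _ ≤ _ := mul_le_mul_of_nonneg_left h' hP.le
      _ = _ := by ring
  have h2 : x ^ n / (n.factorial : ℝ) * (((n : ℝ) / x) ^ m)⁻¹ ≤
      (1 + m : ℝ) ^ m * (x ^ (n + m) / ((n + m).factorial : ℝ)) := by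
    have h : ((n + m).factorial : ℝ) ≤ n.factorial * ((1 + m : ℝ) ^ m * (n : ℝ) ^ m) := by
      exact_mod_cast factorial_add_le_mul_pow hn m
    have e : x ^ n / (n.factorial : ℝ) * (((n : ℝ) / x) ^ m)⁻¹ =
        x ^ (n + m) / (n.factorial * (n : ℝ) ^ m) := by
      rw [div_pow, inv_div, pow_add, div_mul_div_comm]
    rw [e, ← mul_div_assoc, div_le_div_iff₀ (by positivity) (by positivity)]
    calc _ ≤ _ := mul_le_mul_of_nonneg_left h (by positivity : 0 ≤ x ^ (n + m))
      _ = _ := by ring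
  calc x ^ n / (n.factorial : ℝ) * (n : ℝ) ^ β
      = x ^ β * (x ^ n / (n.factorial : ℝ) * ((n : ℝ) / x) ^ β) := by rw [hsplit]; ring
    _ ≤ x ^ β * (x ^ n / (n.factorial : ℝ) * (((n : ℝ) / x) ^ m + (((n : ℝ) / x) ^ m)⁻¹)) := by
      gcongr
      exact rpow_le_pow_add_inv_pow hr hm
    _ ≤ _ := by
      refine mul_le_mul_of_nonneg_left ?_ (by positivity)
      rw [mul_add]
      exact add_le_add h1 h2

theorem exists_tsum_pow_div_factorial_mul_rpow_le {N : ℕ} (hN : 1 ≤ N) (β : ℝ) :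
    ∃ C > 0, ∀ x : ℝ, 1 ≤ x →
      Summable (fun k : ℕ =>
        x ^ (k + N) / ((k + N).factorial : ℝ) * ((k + N : ℕ) : ℝ) ^ β) ∧
      ∑' k : ℕ, x ^ (k + N) / ((k + N).factorial : ℝ) * ((k + N : ℕ) : ℝ) ^ β ≤
        C * x ^ β * Real.exp x := by
  obtain ⟨m, hm⟩ := exists_nat_ge |β|
  refine ⟨(2 * m : ℝ) ^ m + 2 ^ m + (1 + m : ℝ) ^ m, by positivity, fun x hx => ?_⟩
  have hx0 : 0 < x := by linarith
  have shift : ∀ (f : ℕ → ℝ), (∀ n, 0 ≤ f n) → HasSum f (Real.exp x) → ∀ j : ℕ,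
      Summable (fun k => f (k + j)) ∧ ∑' k, f (k + j) ≤ Real.exp x := by
    intro f hf hs j
    refine ⟨hs.summable.comp_injective (add_left_injective j), ?_⟩
    rw [← hs.tsum_eq]
    exact tsum_comp_le_tsum_of_inj hs.summable hf (add_left_injective j)
  have hA := shift _ (fun n => by positivity) (hasSum_pow_div_factorial x) N
  have hB := shift _ (fun n => by positivity)
    (hasSum_pow_div_factorial_mul_descFactorial hx0.ne' m) N
  have hD := shift _ (fun n => by positivity) (hasSum_pow_div_factorial x) (N + m)
  simp only [← add_assoc] at hD
  have hG := (((hA.1.hasSum.mul_left ((2 * m : ℝ) ^ m)).add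
    (hB.1.hasSum.mul_left (2 ^ m))).add (hD.1.hasSum.mul_left ((1 + m : ℝ) ^ m))).mul_left (x ^ β)
  have hle := fun k : ℕ => pow_div_factorial_mul_rpow_le hx hm (le_add_left hN : 1 ≤ k + N)
  have hS : Summable (fun k : ℕ =>
      x ^ (k + N) / ((k + N).factorial : ℝ) * ((k + N : ℕ) : ℝ) ^ β) :=
    Summable.of_nonneg_of_le (fun k => by positivity) hle hG.summable
  refine ⟨hS, (hasSum_le hle hS.hasSum hG).trans ?_⟩
  calc _ ≤ x ^ β * ((2 * m : ℝ) ^ m * Real.exp x + 2 ^ m * Real.exp x +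
        (1 + m : ℝ) ^ m * Real.exp x) := by
        gcongr
        exacts [hA.2, hB.2, hD.2]
    _ = _ := by ring

theorem eventually_half_exp_le_tsum (N : ℕ) :
    ∀ᶠ x : ℝ in atTop,
      Real.exp x / 2 ≤ ∑' k : ℕ, x ^ (k + N) / ((k + N).factorial : ℝ) := by
  have h : Tendsto (fun x : ℝ => ∑ n ∈ Finset.range N,
      x ^ n * Real.exp (-x) / (n.factorial : ℝ)) atTop (𝓝 0) := by
    have := tendsto_finsetSum (Finset.range N) (fun n _ =>
      (Real.tendsto_pow_mul_exp_neg_atTop_nhds_zero n).div_const (n.factorial : ℝ))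
    simpa using this
  filter_upwards [h.eventually (gt_mem_nhds (by norm_num : (0 : ℝ) < 1 / 2))] with x hx
  have hs := hasSum_pow_div_factorial x
  have hsum := hs.summable.sum_add_tsum_nat_add N
  rw [hs.tsum_eq] at hsum
  have he : ∑ n ∈ Finset.range N, x ^ n / (n.factorial : ℝ) =
      Real.exp x * ∑ n ∈ Finset.range N, x ^ n * Real.exp (-x) / (n.factorial : ℝ) := by
    rw [Finset.mul_sum]
    refine Finset.sum_congr rfl fun n _ => ?_
    rw [Real.exp_neg]
    field_simp
  nlinarith [Real.exp_pos x]

/-- By the arithmetic-geometric mean inequality, an upper bound for the exponent `-β` gives a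
lower bound for the exponent `β`. -/
theorem le_tsum_of_tsum_neg_le {N : ℕ} (hN : 1 ≤ N) {β C x : ℝ} (hC : 0 < C) (hx : 0 < x)
    (hs : Summable (fun k : ℕ =>
      x ^ (k + N) / ((k + N).factorial : ℝ) * ((k + N : ℕ) : ℝ) ^ β))
    (hs' : Summable (fun k : ℕ =>
      x ^ (k + N) / ((k + N).factorial : ℝ) * ((k + N : ℕ) : ℝ) ^ (-β)))
    (hle : ∑' k : ℕ, x ^ (k + N) / ((k + N).factorial : ℝ) * ((k + N : ℕ) : ℝ) ^ (-β) ≤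
      C * x ^ (-β) * Real.exp x)
    (hhalf : Real.exp x / 2 ≤ ∑' k : ℕ, x ^ (k + N) / ((k + N).factorial : ℝ)) :
    1 / (4 * C) * x ^ β * Real.exp x ≤
      ∑' k : ℕ, x ^ (k + N) / ((k + N).factorial : ℝ) * ((k + N : ℕ) : ℝ) ^ β := by
  have hy : 0 < x ^ β := Real.rpow_pos_of_pos hx β
  set c : ℝ := x ^ β / (2 * C) with hc
  have hc0 : 0 < c := by positivity
  have hP : Summable (fun k : ℕ => x ^ (k + N) / ((k + N).factorial : ℝ)) :=
    (hasSum_pow_div_factorial x).summable.comp_injective (add_left_injective N)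
  have key := hasSum_le (fun k : ℕ => by
    have hk : (0 : ℝ) < ((k + N : ℕ) : ℝ) := by exact_mod_cast (by omega : 0 < k + N)
    have hu : 0 < ((k + N : ℕ) : ℝ) ^ β := Real.rpow_pos_of_pos hk β
    have hw : 0 ≤ x ^ (k + N) / ((k + N).factorial : ℝ) := by positivity
    show 2 * c * (x ^ (k + N) / ((k + N).factorial : ℝ)) ≤
      x ^ (k + N) / ((k + N).factorial : ℝ) * ((k + N : ℕ) : ℝ) ^ β +
        c ^ 2 * (x ^ (k + N) / ((k + N).factorial : ℝ) * ((k + N : ℕ) : ℝ) ^ (-β))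
    rw [Real.rpow_neg hk.le]
    generalize ((k + N : ℕ) : ℝ) ^ β = u at hu
    have : 2 * c ≤ u + c ^ 2 * u⁻¹ := by
      have e : u + c ^ 2 * u⁻¹ - 2 * c = (u - c) ^ 2 * u⁻¹ := by field_simp; ring
      have : 0 ≤ (u - c) ^ 2 * u⁻¹ := by positivity
      linarith
    nlinarith)
    (hP.hasSum.mul_left (2 * c)) (hs.hasSum.add (hs'.hasSum.mul_left (c ^ 2)))
  have h1 := mul_le_mul_of_nonneg_left hhalf (by positivity : 0 ≤ 2 * c)
  have h2 := mul_le_mul_of_nonneg_left hle (by positivity : 0 ≤ c ^ 2)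
  have e : 1 / (4 * C) * x ^ β * Real.exp x =
      2 * c * (Real.exp x / 2) - c ^ 2 * (C * x ^ (-β) * Real.exp x) := by
    rw [Real.rpow_neg hx.le, hc]
    field_simp
    ring
  rw [e]
  linarith

/-- For integers `N ≥ 1`, `α > 0`, `β ∈ ℝ`, there are constants `C > 0`, `t₀ > 0` such that
`(1/C)(αt)^β e^{αt} ≤ Σ_{k=N}^∞ ((αt)^k/k!) k^β ≤ C (αt)^β e^{αt}` for all `t ≥ t₀`. -/
theorem stmt3 (N : ℕ) (hN : 1 ≤ N) (α β : ℝ) (hα : 0 < α) :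
    ∃ C > 0, ∃ t₀ > 0, ∀ t, t₀ ≤ t →
      (1 / C) * (α * t) ^ β * Real.exp (α * t) ≤
          ∑' k : ℕ, ((α * t) ^ (k + N) / (Nat.factorial (k + N) : ℝ)) * ((k + N : ℕ) : ℝ) ^ β ∧
        ∑' k : ℕ, ((α * t) ^ (k + N) / (Nat.factorial (k + N) : ℝ)) * ((k + N : ℕ) : ℝ) ^ β ≤
          C * (α * t) ^ β * Real.exp (α * t) := by
  obtain ⟨C₁, hC₁, h₁⟩ := exists_tsum_pow_div_factorial_mul_rpow_le hN β
  obtain ⟨C₂, hC₂, h₂⟩ := exists_tsum_pow_div_factorial_mul_rpow_le hN (-β)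
  obtain ⟨x₀, hx₀⟩ := eventually_atTop.1 (eventually_half_exp_le_tsum N)
  refine ⟨max C₁ (4 * C₂), lt_max_of_lt_left hC₁, max 1 x₀ / α, by positivity, fun t ht => ?_⟩
  have hx : max 1 x₀ ≤ α * t := by rwa [div_le_iff₀' hα] at ht
  have hx1 : 1 ≤ α * t := (le_max_left _ _).trans hx
  have hxpos : 0 < α * t := by linarith
  obtain ⟨hs, hle⟩ := h₁ _ hx1
  obtain ⟨hs', hle'⟩ := h₂ _ hx1
  have hlow := le_tsum_of_tsum_neg_le hN hC₂ hxpos hs hs' hle'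
    (hx₀ _ ((le_max_right _ _).trans hx))
  constructor
  · refine le_trans ?_ hlow
    gcongr
    exact le_max_right _ _
  · refine hle.trans ?_
    gcongr
    exact le_max_left _ _
end

section
/- Let N ≥ 1 be an integer and β ∈ ℝ with N > β. Then there exists a constant C > 0 (depending only on N and β) such that for every integer k ≥ 0: (k+N)! · (k+N)^{−β} ≥ C · ∏_{l=1}^{k} (l + N − β), where the empty product (k = 0) equals 1. -/
/-- Bernoulli's inequality for nonpositive exponents. -/
theorem one_add_mul_sub_one_le_rpow_of_nonpos {t p : ℝ} (ht : 0 < t) (hp : p ≤ 0) :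
    1 + p * (t - 1) ≤ t ^ p := by
  rw [Real.rpow_def_of_pos ht]
  have h₁ := Real.add_one_le_exp (Real.log t * p)
  have h₂ := mul_le_mul_of_nonpos_left (Real.log_le_sub_one_of_pos ht) hp
  linarith

theorem mul_prod_Icc_le_of_mul_le_succ {f g : ℕ → ℝ} (hg : ∀ k, 0 ≤ g (k + 1))
    (h : ∀ k, f k * g (k + 1) ≤ f (k + 1)) (k : ℕ) :
    f 0 * ∏ l ∈ Finset.Icc 1 k, g l ≤ f k := by
  induction k with
  | zero => simp
  | succ k ih =>
    rw [Finset.prod_Icc_succ_top (by omega), ← mul_assoc]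
    exact (mul_le_mul_of_nonneg_right ih (hg k)).trans (h k)

/-- For `β ≤ 0`, a lower bound for the growth of `x ^ (-β)`. -/
theorem add_one_sub_mul_rpow_le_of_nonpos {x β : ℝ} (hx : 0 < x) (hβ : β ≤ 0) :
    (x + 1 - β) * x ^ (-β) ≤ (x + 1) * (x + 1) ^ (-β) := by
  have hx1 : 0 < x + 1 := by linarith
  have h := one_add_mul_sub_one_le_rpow_of_nonpos (div_pos hx hx1) hβ
  rw [Real.div_rpow hx.le hx1.le] at h
  have e : 1 + β * (x / (x + 1) - 1) = (x + 1 - β) / (x + 1) := by field_simp; ring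
  rw [e, div_le_div_iff₀ hx1 (Real.rpow_pos_of_pos hx1 β)] at h
  rw [Real.rpow_neg hx.le, Real.rpow_neg hx1.le, ← div_eq_mul_inv, ← div_eq_mul_inv,
    div_le_div_iff₀ (Real.rpow_pos_of_pos hx β) (Real.rpow_pos_of_pos hx1 β)]
  linarith

/-- For `0 ≤ β`, an upper bound for the decay of `x ^ (-β)`. -/
theorem sub_mul_rpow_neg_le_of_nonneg {x β : ℝ} (hx : 0 < x) (hβ : 0 ≤ β) :
    (x - β) * x ^ (-β) ≤ x * (x + 1) ^ (-β) := by
  have hx1 : 0 < x + 1 := by linarith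
  have h := one_add_mul_sub_one_le_rpow_of_nonpos (div_pos hx1 hx) (neg_nonpos.2 hβ)
  rw [Real.div_rpow hx1.le hx.le] at h
  have e : 1 + -β * ((x + 1) / x - 1) = (x - β) / x := by field_simp; ring
  rw [e, div_le_div_iff₀ hx (Real.rpow_pos_of_pos hx _)] at h
  linarith

/-- For an integer `N ≥ 1` and `β ∈ ℝ` with `N > β`, there is a constant `C > 0` such that
`(k+N)! (k+N)^{-β} ≥ C ∏_{l=1}^{k} (l + N - β)` for all `k ≥ 0`. -/
theorem stmt4 (N : ℕ) (hN : 1 ≤ N) (β : ℝ) (hβ : β < N) :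
    ∃ C > 0, ∀ k : ℕ,
      (Nat.factorial (k + N) : ℝ) * ((k + N : ℕ) : ℝ) ^ (-β) ≥
        C * ∏ l ∈ Finset.Icc 1 k, ((l : ℝ) + N - β) := by
  have hN' : (0 : ℝ) < N := by exact_mod_cast hN
  have hg : ∀ k : ℕ, 0 ≤ ((k + 1 : ℕ) : ℝ) + N - β := fun k => by
    push_cast
    linarith [k.cast_nonneg (α := ℝ)]
  have hx : ∀ k : ℕ, (0 : ℝ) < k + N := fun k => by positivity
  have hfac : ∀ k : ℕ, (Nat.factorial (k + 1 + N) : ℝ) = (k + N + 1) * Nat.factorial (k + N) :=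
    fun k => by
      rw [show k + 1 + N = k + N + 1 by omega, Nat.factorial_succ]
      push_cast
      ring
  rcases le_total β 0 with h0 | h0
  · refine ⟨Nat.factorial (0 + N) * ((0 + N : ℕ) : ℝ) ^ (-β), ?_, fun k => ?_⟩
    · rw [zero_add]
      positivity
    · refine mul_prod_Icc_le_of_mul_le_succ
        (f := fun k => (Nat.factorial (k + N) : ℝ) * ((k + N : ℕ) : ℝ) ^ (-β))
        (g := fun l => (l : ℝ) + N - β) hg (fun j => ?_) k
      have h := mul_le_mul_of_nonneg_left (add_one_sub_mul_rpow_le_of_nonpos (hx j) h0)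
        (Nat.factorial (j + N)).cast_nonneg
      simp only [hfac]
      push_cast
      rw [show (j : ℝ) + 1 + N = j + N + 1 by ring]
      linarith
  · refine ⟨Nat.factorial (0 + N) * (((0 + N : ℕ) : ℝ) + 1) ^ (-β), by positivity, fun k => ?_⟩
    refine (mul_prod_Icc_le_of_mul_le_succ
      (f := fun k => (Nat.factorial (k + N) : ℝ) * (((k + N : ℕ) : ℝ) + 1) ^ (-β))
      (g := fun l => (l : ℝ) + N - β) hg (fun j => ?_) k).trans ?_
    · have h := mul_le_mul_of_nonneg_left
        (sub_mul_rpow_neg_le_of_nonneg (add_pos (hx j) one_pos) h0)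
        (Nat.factorial (j + N)).cast_nonneg
      simp only [hfac]
      push_cast
      rw [show (j : ℝ) + 1 + N = j + N + 1 by ring]
      linarith
    · refine mul_le_mul_of_nonneg_left ?_ (Nat.cast_nonneg _)
      exact Real.rpow_le_rpow_of_nonpos (by exact_mod_cast hx k) (by linarith) (by linarith)
end

section
/- Let N ≥ 1 be an integer, α > 0, and let R : [N₀, ∞) → (0, ∞) (with 0 < N₀ ≤ N) be a measurable regularly varying function with index β ∈ ℝ. Set R_k = R(k) for integers k ≥ N. Then there exist constants C > 0 and t₀ > 0 such that for all t ≥ t₀: (1/C)·R(αt)·e^{αt} ≤ Σ_{k=N}^∞ ((αt)^k / k!)·R_k ≤ C·R(αt)·e^{αt}. -/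
open Filter

/-- A measurable function whose increments over each fixed step converge to a linear function of
the step has uniformly bounded increments over steps in `[0, 1]`. -/
theorem exists_bound_increment_of_tendsto {h : ℝ → ℝ} (hm : Measurable h) {β : ℝ}
    (hh : ∀ v, Tendsto (fun u => h (u + v) - h u) atTop (nhds (β * v))) :
    ∃ K T : ℝ, ∀ u, T ≤ u → ∀ v ∈ Set.Icc (0 : ℝ) 1, |h (u + v) - h u| ≤ K := by
  by_contra! hcon
  choose u hu v hv huv using fun n : ℕ => hcon n n
  have hu_top : Tendsto u atTop atTop := tendsto_atTop_mono hu tendsto_natCast_atTop_atTop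
  have huv_top : Tendsto (fun n => u n + v n) atTop atTop :=
    tendsto_atTop_mono (fun n => le_add_of_nonneg_right (hv n).1) hu_top
  have egorov : ∀ a : ℕ → ℝ, Tendsto a atTop atTop → ∃ t : Set ℝ,
      MeasureTheory.volume t ≤ ENNReal.ofReal (1 / 3) ∧
      ∀ᶠ n in atTop, ∀ w ∈ Set.Icc (0 : ℝ) 2, w ∉ t →
        |h (a n + w) - h (a n)| ≤ 2 * |β| + 1 := by
    intro a ha
    obtain ⟨t, -, -, ht, hunif⟩ :=
      MeasureTheory.tendstoUniformlyOn_of_ae_tendsto (μ := MeasureTheory.volume)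
        (s := Set.Icc (0 : ℝ) 2) (f := fun n w => h (a n + w) - h (a n)) (g := fun w => β * w)
        (fun n => ((hm.comp (measurable_const.add measurable_id)).sub
          measurable_const).stronglyMeasurable)
        (measurable_const.mul measurable_id).stronglyMeasurable measurableSet_Icc
        (by simp) (Eventually.of_forall fun w _ => (hh w).comp ha)
        (ε := 1 / 3) (by norm_num)
    refine ⟨t, ht, ?_⟩
    filter_upwards [Metric.tendstoUniformlyOn_iff.1 hunif 1 one_pos] with n hn w hw hwt
    have h1 := hn w ⟨hw, hwt⟩
    rw [Real.dist_eq, abs_sub_comm] at h1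
    have h2 : |β * w| ≤ 2 * |β| := by
      rw [abs_mul, abs_of_nonneg hw.1, mul_comm]
      exact mul_le_mul_of_nonneg_right hw.2 (abs_nonneg β)
    have h3 := abs_sub_abs_le_abs_sub (h (a n + w) - h (a n)) (β * w)
    linarith
  obtain ⟨t₁, ht₁, h₁⟩ := egorov u hu_top
  obtain ⟨t₂, ht₂, h₂⟩ := egorov _ huv_top
  obtain ⟨n, hn₁, hn₂, hn⟩ := (h₁.and (h₂.and
    (tendsto_natCast_atTop_atTop.eventually_ge_atTop (4 * |β| + 2)))).exists
  obtain ⟨w, hw, hwt₁, hwt₂⟩ : ∃ w ∈ Set.Icc (1 : ℝ) 2, w ∉ t₁ ∧ w + -v n ∉ t₂ := by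
    by_contra! hall
    have hsub : Set.Icc (1 : ℝ) 2 ⊆ t₁ ∪ (fun w => w + -v n) ⁻¹' t₂ := fun w hw => by
      by_cases hwt : w ∈ t₁
      · exact Or.inl hwt
      · exact Or.inr (hall w hw hwt)
    have hle := (MeasureTheory.measure_mono (μ := MeasureTheory.volume) hsub).trans
      (MeasureTheory.measure_union_le _ _)
    rw [MeasureTheory.measure_preimage_add_right, Real.volume_Icc] at hle
    have hle' := hle.trans (add_le_add ht₁ ht₂)
    rw [← ENNReal.ofReal_add (by norm_num) (by norm_num),
      ENNReal.ofReal_le_ofReal_iff (by norm_num)] at hle'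
    norm_num at hle'
  have e₁ := hn₁ w ⟨by linarith [hw.1], hw.2⟩ hwt₁
  have e₂ := hn₂ (w + -v n) ⟨by linarith [hw.1, (hv n).2], by linarith [hw.2, (hv n).1]⟩ hwt₂
  rw [show u n + v n + (w + -v n) = u n + w by ring] at e₂
  have e₃ := huv n
  have e₄ : |h (u n + v n) - h (u n)| ≤
      |h (u n + w) - h (u n)| + |h (u n + w) - h (u n + v n)| := by
    have := abs_sub (h (u n + w) - h (u n)) (h (u n + w) - h (u n + v n))
    rwa [show h (u n + w) - h (u n) - (h (u n + w) - h (u n + v n)) =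
      h (u n + v n) - h (u n) by ring] at this
  linarith

theorem abs_sub_le_of_bound_increment {h : ℝ → ℝ} {K T : ℝ}
    (hK : ∀ u, T ≤ u → ∀ v ∈ Set.Icc (0 : ℝ) 1, |h (u + v) - h u| ≤ K)
    {u w : ℝ} (hu : T ≤ u) (hw : T ≤ w) : |h u - h w| ≤ K * (|u - w| + 1) := by
  have hK0 : 0 ≤ K := (abs_nonneg _).trans (hK T le_rfl 0 (by simp))
  have step : ∀ n : ℕ, ∀ a, T ≤ a → ∀ v : ℝ, 0 ≤ v → v ≤ n → |h (a + v) - h a| ≤ K * n := by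
    intro n
    induction n with
    | zero =>
      intro a _ v hv hvn
      obtain rfl : v = 0 := le_antisymm (by simpa using hvn) hv
      simp
    | succ n ih =>
      intro a ha v hv hvn
      push_cast at hvn ⊢
      rcases le_total v 1 with hv1 | hv1
      · have := hK a ha v ⟨hv, hv1⟩
        nlinarith [mul_nonneg hK0 (Nat.cast_nonneg (α := ℝ) n)]
      · have e₁ := ih (a + 1) (by linarith) (v - 1) (by linarith) (by linarith)
        have e₂ := hK a ha 1 (by simp)
        have e₃ := abs_sub_le (h (a + v)) (h (a + 1)) (h a)
        rw [show a + 1 + (v - 1) = a + v by ring] at e₁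
        linarith
  have ordered : ∀ a b, T ≤ a → a ≤ b → |h b - h a| ≤ K * (|b - a| + 1) := by
    intro a b ha hab
    have hba : 0 ≤ b - a := sub_nonneg.2 hab
    have e := step ⌈b - a⌉₊ a ha (b - a) hba (Nat.le_ceil _)
    rw [add_sub_cancel] at e
    rw [abs_of_nonneg hba]
    exact e.trans (mul_le_mul_of_nonneg_left (Nat.ceil_lt_add_one hba).le hK0)
  rcases le_total u w with h' | h'
  · rw [abs_sub_comm, abs_sub_comm u]
    exact ordered u w hu h'
  · exact ordered w u hw h'

/-- A Potter-type bound: the logarithm of a regularly varying function grows at most linearly in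
the logarithm of its argument. -/
theorem exists_potter_bound {R : ℝ → ℝ} (hmeas : Measurable R) {N₀ : ℝ}
    (hpos : ∀ s, N₀ ≤ s → 0 < R s) {β : ℝ}
    (hreg : ∀ lam : ℝ, 0 < lam →
      Tendsto (fun s => R (lam * s) / R s) atTop (nhds (lam ^ β))) :
    ∃ K s₀ : ℝ, 1 ≤ s₀ ∧ N₀ ≤ s₀ ∧ ∀ x y, s₀ ≤ x → s₀ ≤ y →
      |Real.log (R x) - Real.log (R y)| ≤ K * (|Real.log x - Real.log y| + 1) := by
  have hlim : ∀ v, Tendsto (fun u => Real.log (R (Real.exp (u + v))) - Real.log (R (Real.exp u)))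
      atTop (nhds (β * v)) := by
    intro v
    have h1 := ((hreg (Real.exp v) (Real.exp_pos v)).comp Real.tendsto_exp_atTop).log
      (Real.rpow_pos_of_pos (Real.exp_pos v) β).ne'
    rw [Real.log_rpow (Real.exp_pos v), Real.log_exp] at h1
    refine h1.congr' ?_
    filter_upwards [Real.tendsto_exp_atTop.eventually_ge_atTop N₀,
      (Real.tendsto_exp_atTop.comp
        (tendsto_atTop_add_const_right atTop v tendsto_id)).eventually_ge_atTop N₀] with u hu huv
    simp only [Function.comp_apply, id] at huv ⊢
    rw [← Real.exp_add, add_comm v u, Real.log_div (hpos _ huv).ne' (hpos _ hu).ne']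
  obtain ⟨K, T, hK⟩ := exists_bound_increment_of_tendsto
    (h := fun u => Real.log (R (Real.exp u)))
    (Real.measurable_log.comp (hmeas.comp Real.measurable_exp)) hlim
  refine ⟨K, max (max 1 N₀) (Real.exp T), (le_max_left _ _).trans (le_max_left _ _),
    (le_max_right _ _).trans (le_max_left _ _), fun x y hx hy => ?_⟩
  simp only [max_le_iff] at hx hy
  have hx0 : 0 < x := by linarith [hx.1.1]
  have hy0 : 0 < y := by linarith [hy.1.1]
  have := abs_sub_le_of_bound_increment (h := fun u => Real.log (R (Real.exp u))) hK
    ((Real.le_log_iff_exp_le hx0).2 hx.2)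
    ((Real.le_log_iff_exp_le hy0).2 hy.2)
  simpa only [Real.exp_log hx0, Real.exp_log hy0] using this

theorem exp_nat_mul_abs_log_sub_log_le {a b : ℝ} (ha : 0 < a) (hb : 0 < b) (p : ℕ) :
    Real.exp (p * |Real.log a - Real.log b|) ≤ (a / b) ^ p + (b / a) ^ p := by
  have key : ∀ c d : ℝ, 0 < c → 0 < d → Real.exp (p * (Real.log c - Real.log d)) = (c / d) ^ p := by
    intro c d hc hd
    rw [← Real.log_div hc.ne' hd.ne', Real.exp_nat_mul, Real.exp_log (div_pos hc hd)]
  have h1 : 0 ≤ (a / b) ^ p := by positivity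
  have h2 : 0 ≤ (b / a) ^ p := by positivity
  rcases abs_cases (Real.log a - Real.log b) with h | h
  · rw [h.1, key a b ha hb]
    linarith
  · rw [h.1, neg_sub, key b a hb ha]
    linarith

/-- Two-sided comparison of a regularly varying function at integers `k ≥ N` with its value at a
large point `x`. -/
theorem exists_weight_bound {R : ℝ → ℝ} (hmeas : Measurable R) {N : ℕ} (hN : 1 ≤ N) {N₀ : ℝ}
    (hN₀N : N₀ ≤ N) (hpos : ∀ s, N₀ ≤ s → 0 < R s) {β : ℝ}
    (hreg : ∀ lam : ℝ, 0 < lam →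
      Tendsto (fun s => R (lam * s) / R s) atTop (nhds (lam ^ β))) :
    ∃ (p : ℕ) (s₀ : ℝ), 1 ≤ s₀ ∧ N₀ ≤ s₀ ∧ ∀ x, s₀ ≤ x → ∀ k : ℕ, N ≤ k →
      R k ≤ Real.exp p * ((k / x) ^ p + (x / k) ^ p) * R x ∧
      R x ≤ Real.exp p * ((k / x) ^ p + (x / k) ^ p) * R k := by
  obtain ⟨K, s₀, hs1, hsN, hK⟩ := exists_potter_bound hmeas hpos hreg
  have hK0 : 0 ≤ K := by
    have := hK s₀ s₀ le_rfl le_rfl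
    simpa using this
  set B : ℝ := ∑ k ∈ Finset.range ⌈s₀⌉₊, |Real.log (R k) - Real.log (R s₀)|
  have hB0 : 0 ≤ B := Finset.sum_nonneg fun _ _ => abs_nonneg _
  obtain ⟨p, hp⟩ := exists_nat_ge (B + K)
  refine ⟨p, s₀, hs1, hsN, fun x hx k hk => ?_⟩
  have hx0 : 0 < x := by linarith
  have hk0 : (0 : ℝ) < k := by exact_mod_cast hN.trans hk
  have hRx : 0 < R x := hpos x (hsN.trans hx)
  have hRk : 0 < R k := hpos k (hN₀N.trans (by exact_mod_cast hk))
  have main : |Real.log (R k) - Real.log (R x)| ≤ p * (|Real.log k - Real.log x| + 1) := by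
    have hD : 0 ≤ |Real.log k - Real.log x| := abs_nonneg _
    suffices h : |Real.log (R k) - Real.log (R x)| ≤ B + K * (|Real.log k - Real.log x| + 1) by
      nlinarith
    rcases le_or_gt s₀ k with hks | hks
    · linarith [hK k x hks hx]
    · have h1 : |Real.log (R k) - Real.log (R s₀)| ≤ B :=
        Finset.single_le_sum (f := fun k : ℕ => |Real.log (R k) - Real.log (R s₀)|)
          (fun _ _ => abs_nonneg _) (Finset.mem_range.2 (Nat.lt_ceil.2 hks))
      have h2 := hK s₀ x le_rfl hx
      have h3 := abs_sub_le (Real.log (R k)) (Real.log (R s₀)) (Real.log (R x))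
      have h4 : |Real.log s₀ - Real.log x| ≤ |Real.log k - Real.log x| := by
        have l1 := Real.log_le_log hk0 hks.le
        have l2 := Real.log_le_log (by linarith) hx
        rw [abs_of_nonpos (by linarith), abs_of_nonpos (by linarith)]
        linarith
      nlinarith
  have hexp : Real.exp (p * (|Real.log k - Real.log x| + 1)) ≤
      Real.exp p * ((k / x) ^ p + (x / k) ^ p) := by
    rw [mul_add, mul_one, Real.exp_add, mul_comm]
    exact mul_le_mul_of_nonneg_left (exp_nat_mul_abs_log_sub_log_le hk0 hx0 p) (Real.exp_pos _).le
  have compare : ∀ a b : ℝ, 0 < a → 0 < b →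
      Real.log a - Real.log b ≤ p * (|Real.log k - Real.log x| + 1) →
      a ≤ Real.exp p * ((k / x) ^ p + (x / k) ^ p) * b := by
    intro a b ha hb hab
    rw [← div_le_iff₀ hb, ← Real.exp_log (div_pos ha hb), Real.log_div ha.ne' hb.ne']
    exact (Real.exp_le_exp.2 hab).trans hexp
  exact ⟨compare _ _ hRk hRx ((le_abs_self _).trans main),
    compare _ _ hRx hRk (by linarith [neg_abs_le (Real.log (R k) - Real.log (R x))])⟩

theorem tsum_pow_div_factorial (x : ℝ) :
    ∑' k : ℕ, x ^ k / (k.factorial : ℝ) = Real.exp x := by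
  rw [Real.exp_eq_exp_ℝ]
  exact (NormedSpace.expSeries_div_hasSum_exp x).tsum_eq

/-- Tails of the exponential series are at most the exponential. -/
theorem tsum_pow_add_div_factorial_le {x : ℝ} (hx : 0 ≤ x) (n : ℕ) :
    ∑' k : ℕ, x ^ (k + n) / ((k + n).factorial : ℝ) ≤ Real.exp x := by
  rw [← tsum_pow_div_factorial x]
  exact tsum_comp_le_tsum_of_inj (Real.summable_pow_div_factorial x)
    (fun _ => by positivity) (add_left_injective n)

theorem mul_exp_inv_le {x : ℝ} (hx : 1 ≤ x) : x * Real.exp x⁻¹ ≤ x + 2 := by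
  have hx0 : 0 < x := by linarith
  have h1 : |x⁻¹| = x⁻¹ := abs_of_pos (inv_pos.2 hx0)
  have h2 := Real.abs_exp_sub_one_le (x := x⁻¹) (by rw [h1]; exact inv_le_one_of_one_le₀ hx)
  rw [h1] at h2
  have h3 : Real.exp x⁻¹ ≤ 1 + 2 * x⁻¹ := by linarith [le_abs_self (Real.exp x⁻¹ - 1)]
  calc x * Real.exp x⁻¹ ≤ x * (1 + 2 * x⁻¹) := mul_le_mul_of_nonneg_left h3 hx0.le
    _ = x + 2 := by field_simp

/-- Polynomially weighted tails of the exponential series, with the weight centred at `x`. -/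
theorem exists_weighted_exp_tail_bound {N : ℕ} (hN : 1 ≤ N) (p : ℕ) :
    ∃ M > 0, ∀ x : ℝ, 1 ≤ x →
      Summable (fun k : ℕ => x ^ (k + N) / ((k + N).factorial : ℝ) *
        ((((k + N : ℕ) : ℝ) / x) ^ p + (x / ((k + N : ℕ) : ℝ)) ^ p)) ∧
      ∑' k : ℕ, x ^ (k + N) / ((k + N).factorial : ℝ) *
        ((((k + N : ℕ) : ℝ) / x) ^ p + (x / ((k + N : ℕ) : ℝ)) ^ p) ≤ M * Real.exp x := by
  refine ⟨p.factorial * Real.exp 2 + (1 + p) ^ p, by positivity, fun x hx => ?_⟩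
  have hx0 : 0 < x := by linarith
  set y := x * Real.exp x⁻¹ with hy
  have hy0 : 0 ≤ y := by positivity
  have hterm : ∀ k : ℕ, 1 ≤ k → x ^ k / (k.factorial : ℝ) * ((k / x) ^ p + (x / k) ^ p) ≤
      p.factorial * (y ^ k / (k.factorial : ℝ)) +
        (1 + p) ^ p * (x ^ (k + p) / ((k + p).factorial : ℝ)) := by
    intro k hk
    have hk1 : (1 : ℝ) ≤ k := by exact_mod_cast hk
    have hk0 : (0 : ℝ) < k := by linarith
    rw [mul_add]
    refine add_le_add ?_ ?_
    · have h1 : ((k : ℝ) / x) ^ p ≤ p.factorial * Real.exp (k * x⁻¹) := by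
        have := Real.pow_div_factorial_le_exp (k / x) (by positivity) p
        rw [div_le_iff₀ (by positivity)] at this
        rw [← div_eq_mul_inv]
        linarith
      rw [Real.exp_nat_mul] at h1
      calc x ^ k / (k.factorial : ℝ) * ((k : ℝ) / x) ^ p
          ≤ x ^ k / (k.factorial : ℝ) * (p.factorial * Real.exp x⁻¹ ^ k) := by gcongr
        _ = p.factorial * (y ^ k / (k.factorial : ℝ)) := by rw [hy, mul_pow]; ring
    · have h1 : ((k + p).factorial : ℝ) ≤ k.factorial * ((1 + p) * k) ^ p := by
        have h2 : ((k + p).factorial : ℝ) ≤ k.factorial * (k + p) ^ p := by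
          rw [← Nat.factorial_mul_ascFactorial]
          exact_mod_cast Nat.mul_le_mul_left _ (Nat.ascFactorial_le_pow_add k p)
        refine h2.trans ?_
        gcongr
        nlinarith [Nat.cast_nonneg (α := ℝ) p]
      rw [div_pow, div_mul_div_comm, ← pow_add, ← mul_div_assoc,
        div_le_div_iff₀ (by positivity) (by positivity)]
      rw [mul_pow] at h1
      calc x ^ (k + p) * ((k + p).factorial : ℝ)
          ≤ x ^ (k + p) * (k.factorial * ((1 + p) ^ p * k ^ p)) := by gcongr
        _ = _ := by ring
  have hs₁ := ((summable_nat_add_iff N).2 (Real.summable_pow_div_factorial y)).mul_left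
    (p.factorial : ℝ)
  have hs₂ := ((summable_nat_add_iff (N + p)).2 (Real.summable_pow_div_factorial x)).mul_left
    ((1 + p : ℝ) ^ p)
  have hle : ∀ k : ℕ, _ := fun k => hterm (k + N) (hN.trans (Nat.le_add_left N k))
  simp only [add_assoc _ N p] at hle
  have hsum := Summable.of_nonneg_of_le (fun k => by positivity) hle (hs₁.add hs₂)
  refine ⟨hsum, (hsum.tsum_le_tsum hle (hs₁.add hs₂)).trans ?_⟩
  rw [hs₁.tsum_add hs₂, tsum_mul_left, tsum_mul_left, add_mul, mul_assoc _ (Real.exp 2),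
    ← Real.exp_add]
  gcongr
  · refine (tsum_pow_add_div_factorial_le hy0 N).trans (Real.exp_le_exp.2 ?_)
    linarith [mul_exp_inv_le hx]
  · exact tsum_pow_add_div_factorial_le hx0.le (N + p)

/-- The tail of the exponential series from a fixed index carries most of the exponential. -/
theorem eventually_exp_tail_ge (N : ℕ) : ∀ᶠ x : ℝ in atTop,
    3 / 4 * Real.exp x ≤ ∑' k : ℕ, x ^ (k + N) / ((k + N).factorial : ℝ) := by
  have hlim : Tendsto (fun x : ℝ => ∑ k ∈ Finset.range N,
      (x ^ k * Real.exp (-x)) / (k.factorial : ℝ)) atTop (nhds 0) := by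
    have := tendsto_finsetSum (Finset.range N) fun k _ =>
      (Real.tendsto_pow_mul_exp_neg_atTop_nhds_zero k).div_const (k.factorial : ℝ)
    simpa using this
  filter_upwards [hlim.eventually_le_const (show (0 : ℝ) < 1 / 4 by norm_num)] with x hx
  have hsplit := (Real.summable_pow_div_factorial x).sum_add_tsum_nat_add N
  rw [tsum_pow_div_factorial] at hsplit
  have hhead : ∑ k ∈ Finset.range N, x ^ k / (k.factorial : ℝ) ≤ 1 / 4 * Real.exp x := by
    have h := mul_le_mul_of_nonneg_right hx (Real.exp_pos x).le
    rw [Finset.sum_mul] at h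
    refine (Finset.sum_congr rfl fun k _ => ?_).trans_le h
    rw [Real.exp_neg]
    field_simp
  linarith

/-- For an integer `N ≥ 1`, `α > 0` and a measurable regularly varying function
`R : [N₀, ∞) → (0, ∞)` with index `β ∈ ℝ` (where `0 < N₀ ≤ N`), setting `R_k = R(k)`,
there are constants `C > 0`, `t₀ > 0` such that
`(1/C) R(αt) e^{αt} ≤ Σ_{k=N}^∞ ((αt)^k/k!) R_k ≤ C R(αt) e^{αt}` for all `t ≥ t₀`. -/
theorem stmt5 (N : ℕ) (hN : 1 ≤ N) (α : ℝ) (hα : 0 < α)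
    (N₀ : ℝ) (hN₀ : 0 < N₀) (hN₀N : N₀ ≤ N)
    (R : ℝ → ℝ) (hmeas : Measurable R) (hpos : ∀ s, N₀ ≤ s → 0 < R s) (β : ℝ)
    (hreg : ∀ lam : ℝ, 0 < lam →
      Tendsto (fun s => R (lam * s) / R s) atTop (nhds (lam ^ β))) :
    ∃ C > 0, ∃ t₀ > 0, ∀ t, t₀ ≤ t →
      (1 / C) * R (α * t) * Real.exp (α * t) ≤
          ∑' k : ℕ, ((α * t) ^ (k + N) / (Nat.factorial (k + N) : ℝ)) * R ((k + N : ℕ) : ℝ) ∧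
        ∑' k : ℕ, ((α * t) ^ (k + N) / (Nat.factorial (k + N) : ℝ)) * R ((k + N : ℕ) : ℝ) ≤
          C * R (α * t) * Real.exp (α * t) := by
  obtain ⟨p, s₀, hs1, hsN, hR⟩ := exists_weight_bound hmeas hN hN₀N hpos hreg
  obtain ⟨M, hM, hW⟩ := exists_weighted_exp_tail_bound hN p
  obtain ⟨x₀, hx₀⟩ := eventually_atTop.1 (eventually_exp_tail_ge N)
  have hp := Real.exp_pos (p : ℝ)
  refine ⟨2 * M * Real.exp p, by positivity, max s₀ x₀ / α,
    div_pos (lt_max_of_lt_left (by linarith)) hα, fun t ht => ?_⟩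
  rw [div_le_iff₀ hα, mul_comm t] at ht
  generalize α * t = x at ht ⊢
  have hxs : s₀ ≤ x := (le_max_left _ _).trans ht
  have hx0 : 0 < x := by linarith
  have hRx : 0 < R x := hpos x (hsN.trans hxs)
  obtain ⟨hsum, hle⟩ := hW x (hs1.trans hxs)
  have htail := hx₀ x ((le_max_right _ _).trans ht)
  set a : ℕ → ℝ := fun k => x ^ (k + N) / ((k + N).factorial : ℝ)
  set w : ℕ → ℝ := fun k => (((k + N : ℕ) : ℝ) / x) ^ p + (x / ((k + N : ℕ) : ℝ)) ^ p
  have ha0 : ∀ k, 0 ≤ a k := fun k => by positivity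
  have hw0 : ∀ k, 0 < w k := fun k => by
    have : (0 : ℝ) < (k + N : ℕ) := by exact_mod_cast hN.trans (Nat.le_add_left N k)
    positivity
  have hub : ∀ k, a k * R (k + N : ℕ) ≤ Real.exp p * R x * (a k * w k) := fun k => by
    have := mul_le_mul_of_nonneg_left (hR x hxs (k + N) (Nat.le_add_left N k)).1 (ha0 k)
    linarith
  -- The tangent-line bound `1 / w ≥ 2 / M - w / M ^ 2` reduces the lower estimate to the upper one.
  have hlb : ∀ k, R x / Real.exp p * (2 / M * a k - 1 / M ^ 2 * (a k * w k)) ≤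
      a k * R (k + N : ℕ) := fun k => by
    have h1 : R x / (Real.exp p * w k) ≤ R (k + N : ℕ) := by
      rw [div_le_iff₀ (mul_pos hp (hw0 k)), mul_comm (R _)]
      exact (hR x hxs (k + N) (Nat.le_add_left N k)).2
    have h2 : 2 / M - 1 / M ^ 2 * w k ≤ 1 / w k := by
      have hwk := hw0 k
      have : 1 / w k - (2 / M - 1 / M ^ 2 * w k) = (w k - M) ^ 2 / (M ^ 2 * w k) := by
        field_simp
        ring
      have h3 : 0 ≤ (w k - M) ^ 2 / (M ^ 2 * w k) := by positivity
      linarith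
    calc R x / Real.exp p * (2 / M * a k - 1 / M ^ 2 * (a k * w k))
        = a k * (R x / Real.exp p * (2 / M - 1 / M ^ 2 * w k)) := by ring
      _ ≤ a k * (R x / Real.exp p * (1 / w k)) := by
        have := ha0 k
        gcongr
      _ = a k * (R x / (Real.exp p * w k)) := by rw [div_mul_div_comm, mul_one]
      _ ≤ a k * R (k + N : ℕ) := mul_le_mul_of_nonneg_left h1 (ha0 k)
  have hpos' : ∀ k : ℕ, 0 ≤ a k * R (k + N : ℕ) := fun k =>
    mul_nonneg (ha0 k) (hpos _ (hN₀N.trans (by exact_mod_cast Nat.le_add_left N k))).le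
  have hsumR : Summable fun k : ℕ => a k * R (k + N : ℕ) :=
    Summable.of_nonneg_of_le hpos' hub (hsum.mul_left _)
  have hsuma : Summable a := (summable_nat_add_iff N).2 (Real.summable_pow_div_factorial x)
  have hE := Real.exp_pos x
  constructor
  · have h1 := (((hsuma.mul_left (2 / M)).sub (hsum.mul_left (1 / M ^ 2))).mul_left
      (R x / Real.exp p)).tsum_le_tsum hlb hsumR
    rw [tsum_mul_left, (hsuma.mul_left (2 / M)).tsum_sub (hsum.mul_left (1 / M ^ 2)),
      tsum_mul_left, tsum_mul_left] at h1
    refine le_trans ?_ h1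
    calc 1 / (2 * M * Real.exp p) * R x * Real.exp x
        = R x / Real.exp p * (2 / M * (3 / 4 * Real.exp x) - 1 / M ^ 2 * (M * Real.exp x)) := by
          field_simp
          ring
      _ ≤ _ := by gcongr
  · have h1 := hsumR.tsum_le_tsum hub (hsum.mul_left _)
    rw [tsum_mul_left] at h1
    calc _ ≤ _ := h1
      _ ≤ Real.exp p * R x * (M * Real.exp x) := by gcongr
      _ ≤ 2 * M * Real.exp p * R x * Real.exp x := by
        have : 0 ≤ M * Real.exp p * R x * Real.exp x := by positivity
        linarith
end
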